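/- The function Δ(τ) = η(τ)^{24} satisfies Δ((aτ+b)/(cτ+d)) = (cτ+d)^{12} Δ(τ) for all integers a,b,c,d with ad-bc=1 and all τ with Im τ > 0; i.e., η^{24} is a modular form of weight 12 for SL(2,ℤ). -/

import Mathlib

open Complex Real

noncomputable def dedekindEta (τ : ℂ) : ℂ :=
  Complex.exp (π * I * τ / 12) * ∏' n : ℕ, (1 - Complex.exp (2 * π * I * (n + 1) * τ))

lemma dedekindEta_eq_eta (z : ℂ) : dedekindEta z = ModularForm.eta z := by
  simp only [dedekindEta, ModularForm.eta, ModularForm.eta_q_eq_cexp, Function.Periodic.qParam]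
  congr 2
  push_cast
  ring

theorem eta_pow_24_modular (a b c d : ℤ) (h : a * d - b * c = 1)
    (τ : ℂ) (hτ : 0 < τ.im) :
    (dedekindEta ((a * τ + b) / (c * τ + d))) ^ 24 =
      (c * τ + d) ^ 12 * (dedekindEta τ) ^ 24 := by
  let A : Matrix.SpecialLinearGroup (Fin 2) ℤ := ⟨!![a, b; c, d], by
    rw [Matrix.det_fin_two_of]; exact h⟩
  let z : UpperHalfPlane := ⟨τ, hτ⟩
  have key := congrFun (SlashInvariantForm.slash_action_generators_SL2Z
    ModularForm.discriminant_S_invariant ModularForm.discriminant_T_invariant A) z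
  have hd : UpperHalfPlane.denom A z = c * τ + d := by
    rw [ModularGroup.denom_apply]
    simp [A, z]
  have hne : (c * τ + d : ℂ) ≠ 0 := hd ▸ UpperHalfPlane.denom_ne_zero _ z
  have hz : ((A • z : UpperHalfPlane) : ℂ) = (a * τ + b) / (c * τ + d) := by
    rw [UpperHalfPlane.coe_specialLinearGroup_apply]
    simp [A, z]
  rw [ModularForm.SL_slash_apply, hd, ModularForm.discriminant, ModularForm.discriminant, hz] at key
  rw [dedekindEta_eq_eta, dedekindEta_eq_eta]
  change _ = ModularForm.eta τ ^ 24 at key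
  have h12 : (c * τ + d : ℂ) ^ (12 : ℤ) = (c * τ + d : ℂ) ^ 12 := by norm_cast
  rw [← key, zpow_neg, h12, mul_left_comm, mul_inv_cancel₀ (pow_ne_zero _ hne), mul_one]
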